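/- Let Ω_ℂ be an open subset of the open upper half-plane {z ∈ ℂ : Im z > 0} and let F : Ω_ℂ → ℂ be holomorphic, written F = U + iV with U, V real-valued. Let Ω = {p ∈ H : p is off the real axis and t(p) + r(p)·i ∈ Ω_ℂ}, and define f : Ω → H by f(p) = U(t(p) + r(p)·i) + ι(p)·V(t(p) + r(p)·i). Then f is both left-hyperholomorphic and right-hyperholomorphic on Ω: (D_l f)(p) = (D_r f)(p) = −2·V(t(p) + r(p)·i)/r(p) for all p ∈ Ω. -/

import Mathlib

open Quaternion MeasureTheory

noncomputable section

/-- `r(p)` : distance from the real axis. -/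
def rr (p : ℍ[ℝ]) : ℝ := Real.sqrt (p.imI ^ 2 + p.imJ ^ 2 + p.imK ^ 2)

def qi : ℍ[ℝ] := ⟨0, 1, 0, 0⟩
def qj : ℍ[ℝ] := ⟨0, 0, 1, 0⟩
def qk : ℍ[ℝ] := ⟨0, 0, 0, 1⟩

/-- imaginary part of a quaternion -/
def qim (p : ℍ[ℝ]) : ℍ[ℝ] := ⟨0, p.imI, p.imJ, p.imK⟩

/-- `ι(p)` -/
def iota (p : ℍ[ℝ]) : ℍ[ℝ] := (rr p)⁻¹ • qim p

/-- left Fueter operator -/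
def Dl (f : ℍ[ℝ] → ℍ[ℝ]) (p : ℍ[ℝ]) : ℍ[ℝ] :=
  fderiv ℝ f p 1 + qi * fderiv ℝ f p qi + qj * fderiv ℝ f p qj + qk * fderiv ℝ f p qk

/-- right Fueter operator -/
def Dr (f : ℍ[ℝ] → ℍ[ℝ]) (p : ℍ[ℝ]) : ℍ[ℝ] :=
  fderiv ℝ f p 1 + fderiv ℝ f p qi * qi + fderiv ℝ f p qj * qj + fderiv ℝ f p qk * qk

/-- hyperholomorphic on `Ω` with decomposition `f = u + ι v` -/
def Hyperholo (Ω : Set ℍ[ℝ]) (f : ℍ[ℝ] → ℍ[ℝ]) (u v : ℍ[ℝ] → ℝ) : Prop :=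
  (∀ p ∈ Ω, DifferentiableAt ℝ f p) ∧
  (∀ p ∈ Ω, f p = (u p : ℍ[ℝ]) + iota p * (v p : ℍ[ℝ])) ∧
  (∀ p ∈ Ω, Dl f p = ((-2 * v p / rr p : ℝ) : ℍ[ℝ]))

/-- spherical parametrization of the imaginary unit sphere -/
def iotaSph (α β : ℝ) : ℍ[ℝ] :=
  ⟨0, Real.cos α * Real.sin β, Real.sin α * Real.sin β, Real.cos β⟩

/-- the point `t + r·ι(α,β)` -/
def pt (t r α β : ℝ) : ℍ[ℝ] := (t : ℍ[ℝ]) + (r : ℍ[ℝ]) * iotaSph α β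


@[simp] lemma qim_re (p : ℍ[ℝ]) : (qim p).re = 0 := rfl
@[simp] lemma qim_imI (p : ℍ[ℝ]) : (qim p).imI = p.imI := rfl
@[simp] lemma qim_imJ (p : ℍ[ℝ]) : (qim p).imJ = p.imJ := rfl
@[simp] lemma qim_imK (p : ℍ[ℝ]) : (qim p).imK = p.imK := rfl

@[simp] lemma qi_re : qi.re = 0 := rfl
@[simp] lemma qi_imI : qi.imI = 1 := rfl
@[simp] lemma qi_imJ : qi.imJ = 0 := rfl
@[simp] lemma qi_imK : qi.imK = 0 := rfl

@[simp] lemma qj_re : qj.re = 0 := rfl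
@[simp] lemma qj_imI : qj.imI = 0 := rfl
@[simp] lemma qj_imJ : qj.imJ = 1 := rfl
@[simp] lemma qj_imK : qj.imK = 0 := rfl

@[simp] lemma qk_re : qk.re = 0 := rfl
@[simp] lemma qk_imI : qk.imI = 0 := rfl
@[simp] lemma qk_imJ : qk.imJ = 0 := rfl
@[simp] lemma qk_imK : qk.imK = 1 := rfl

/-- The real part as a continuous linear map. -/
def reL : ℍ[ℝ] →L[ℝ] ℝ :=
  LinearMap.toContinuousLinearMap
    { toFun := fun p => p.re, map_add' := fun _ _ => rfl, map_smul' := fun _ _ => rfl }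

/-- The coordinate `imI` as a continuous linear map. -/
def imIL : ℍ[ℝ] →L[ℝ] ℝ :=
  LinearMap.toContinuousLinearMap
    { toFun := fun p => p.imI, map_add' := fun _ _ => rfl, map_smul' := fun _ _ => rfl }

/-- The coordinate `imJ` as a continuous linear map. -/
def imJL : ℍ[ℝ] →L[ℝ] ℝ :=
  LinearMap.toContinuousLinearMap
    { toFun := fun p => p.imJ, map_add' := fun _ _ => rfl, map_smul' := fun _ _ => rfl }

/-- The coordinate `imK` as a continuous linear map. -/
def imKL : ℍ[ℝ] →L[ℝ] ℝ :=
  LinearMap.toContinuousLinearMap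
    { toFun := fun p => p.imK, map_add' := fun _ _ => rfl, map_smul' := fun _ _ => rfl }

/-- `qim` as a continuous linear map. -/
def qimL : ℍ[ℝ] →L[ℝ] ℍ[ℝ] :=
  LinearMap.toContinuousLinearMap
    { toFun := qim
      map_add' := fun _ _ => by ext <;> simp
      map_smul' := fun _ _ => by ext <;> simp }

@[simp] lemma reL_apply (p : ℍ[ℝ]) : reL p = p.re := rfl
@[simp] lemma imIL_apply (p : ℍ[ℝ]) : imIL p = p.imI := rfl
@[simp] lemma imJL_apply (p : ℍ[ℝ]) : imJL p = p.imJ := rfl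
@[simp] lemma imKL_apply (p : ℍ[ℝ]) : imKL p = p.imK := rfl
@[simp] lemma qimL_apply (p : ℍ[ℝ]) : qimL p = qim p := rfl

lemma rr_sq (p : ℍ[ℝ]) : rr p ^ 2 = p.imI ^ 2 + p.imJ ^ 2 + p.imK ^ 2 :=
  Real.sq_sqrt (by positivity)

lemma rr_ne_zero {p : ℍ[ℝ]} (hp : qim p ≠ 0) : rr p ≠ 0 := by
  intro h
  have h2 := rr_sq p
  rw [h] at h2
  apply hp
  ext
  · rfl
  · change p.imI = 0
    nlinarith [sq_nonneg p.imI, sq_nonneg p.imJ, sq_nonneg p.imK]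
  · change p.imJ = 0
    nlinarith [sq_nonneg p.imI, sq_nonneg p.imJ, sq_nonneg p.imK]
  · change p.imK = 0
    nlinarith [sq_nonneg p.imI, sq_nonneg p.imJ, sq_nonneg p.imK]

/-- The derivative of `rr` at `p`. -/
def rrDeriv (p : ℍ[ℝ]) : ℍ[ℝ] →L[ℝ] ℝ :=
  (rr p)⁻¹ • (p.imI • imIL + p.imJ • imJL + p.imK • imKL)

lemma hasFDerivAt_rr {p : ℍ[ℝ]} (hp : rr p ≠ 0) : HasFDerivAt rr (rrDeriv p) p := by
  have hs : p.imI ^ 2 + p.imJ ^ 2 + p.imK ^ 2 ≠ 0 := by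
    rw [← rr_sq]
    exact pow_ne_zero 2 hp
  have h := ((((imIL.hasFDerivAt (x := p)).pow 2).add ((imJL.hasFDerivAt (x := p)).pow 2)).add
    ((imKL.hasFDerivAt (x := p)).pow 2)).sqrt hs
  refine h.congr_fderiv ?_
  ext q
  change 1 / (2 * rr p) * _ = _
  simp [rrDeriv]
  field_simp

/-- The point of the closed upper half-plane determined by a quaternion. -/
def halfPlanePoint (p : ℍ[ℝ]) : ℂ := (p.re : ℂ) + (rr p : ℂ) * Complex.I

lemma continuous_halfPlanePoint : Continuous halfPlanePoint := by
  have h0 : Continuous fun p : ℍ[ℝ] => p.re := reL.continuous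
  have h1 : Continuous fun p : ℍ[ℝ] => p.imI := imIL.continuous
  have h2 : Continuous fun p : ℍ[ℝ] => p.imJ := imJL.continuous
  have h3 : Continuous fun p : ℍ[ℝ] => p.imK := imKL.continuous
  unfold halfPlanePoint rr
  fun_prop

lemma hasFDerivAt_halfPlanePoint {p : ℍ[ℝ]} (hp : rr p ≠ 0) :
    HasFDerivAt halfPlanePoint
      (Complex.ofRealCLM.comp reL + Complex.I • Complex.ofRealCLM.comp (rrDeriv p)) p := by
  have h := ((Complex.ofRealCLM.comp reL).hasFDerivAt (x := p)).add
    ((Complex.ofRealCLM.hasFDerivAt.comp p (hasFDerivAt_rr hp)).mul_const Complex.I)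
  exact h

/-- The quaternionic lift `U + ι V` of a complex function `U + i V`. -/
def intrinsicLift (F : ℂ → ℂ) (p : ℍ[ℝ]) : ℍ[ℝ] :=
  ((F (halfPlanePoint p)).re : ℍ[ℝ]) + iota p * ((F (halfPlanePoint p)).im : ℍ[ℝ])

lemma intrinsicLift_eq_smul (F : ℂ → ℂ) (p : ℍ[ℝ]) :
    intrinsicLift F p = (F (halfPlanePoint p)).re • (1 : ℍ[ℝ]) +
      ((F (halfPlanePoint p)).im * (rr p)⁻¹) • qim p := by
  rw [intrinsicLift, iota, Quaternion.mul_coe_eq_smul, smul_smul,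
    ← Quaternion.mul_coe_eq_smul _ (1 : ℍ[ℝ]), one_mul]

lemma exists_hasFDerivAt_intrinsicLift {F : ℂ → ℂ} {F' : ℂ} {p : ℍ[ℝ]} (hp : rr p ≠ 0)
    (hF : HasDerivAt F F' (halfPlanePoint p)) :
    ∃ L : ℍ[ℝ] →L[ℝ] ℍ[ℝ], HasFDerivAt (intrinsicLift F) L p ∧
      ∀ q, L q = (F'.re * q.re - F'.im * rrDeriv p q) • (1 : ℍ[ℝ]) +
        (((F'.im * q.re + F'.re * rrDeriv p q) * (rr p)⁻¹ -
          (F (halfPlanePoint p)).im * rrDeriv p q * ((rr p)⁻¹) ^ 2) • qim p +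
          ((F (halfPlanePoint p)).im * (rr p)⁻¹) • qim q) := by
  have hc := hF.hasFDerivAt.restrictScalars ℝ |>.comp p (hasFDerivAt_halfPlanePoint hp)
  have hU := Complex.reCLM.hasFDerivAt.comp p hc
  have hV := Complex.imCLM.hasFDerivAt.comp p hc
  have hinv := (hasDerivAt_inv hp).comp_hasFDerivAt p (hasFDerivAt_rr hp)
  have h := (hU.smul_const (1 : ℍ[ℝ])).add ((hV.mul hinv).smul (qimL.hasFDerivAt (x := p)))
  refine ⟨_, h.congr_of_eventuallyEq (.of_forall (intrinsicLift_eq_smul F)), fun q => ?_⟩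
  ext <;> simp <;> ring

lemma Dl_intrinsicLift {F : ℂ → ℂ} {F' : ℂ} {p : ℍ[ℝ]} (hp : rr p ≠ 0)
    (hF : HasDerivAt F F' (halfPlanePoint p)) :
    Dl (intrinsicLift F) p = ((-2 * (F (halfPlanePoint p)).im / rr p : ℝ) : ℍ[ℝ]) := by
  obtain ⟨L, hL, h⟩ := exists_hasFDerivAt_intrinsicLift hp hF
  have hr := rr_sq p
  rw [Dl, hL.fderiv, h, h, h, h]
  ext <;> simp [rrDeriv, -Quaternion.coe_div] <;> field_simp <;> grind only

lemma Dr_intrinsicLift {F : ℂ → ℂ} {F' : ℂ} {p : ℍ[ℝ]} (hp : rr p ≠ 0)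
    (hF : HasDerivAt F F' (halfPlanePoint p)) :
    Dr (intrinsicLift F) p = ((-2 * (F (halfPlanePoint p)).im / rr p : ℝ) : ℍ[ℝ]) := by
  obtain ⟨L, hL, h⟩ := exists_hasFDerivAt_intrinsicLift hp hF
  have hr := rr_sq p
  rw [Dr, hL.fderiv, h, h, h, h]
  ext <;> simp [rrDeriv, -Quaternion.coe_div] <;> field_simp <;> grind only

/-- A holomorphic function on an open subset of the upper half-plane lifts to a
quaternionic function that is both left- and right-hyperholomorphic. -/
theorem intrinsic_holomorphic_lift (Ωc : Set ℂ) (hΩc : IsOpen Ωc)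
    (hup : Ωc ⊆ {z : ℂ | 0 < z.im}) (F : ℂ → ℂ) (hF : DifferentiableOn ℂ F Ωc)
    (Ω : Set ℍ[ℝ])
    (hΩdef : Ω = {p : ℍ[ℝ] | qim p ≠ 0 ∧ ((p.re : ℂ) + (rr p : ℂ) * Complex.I) ∈ Ωc})
    (f : ℍ[ℝ] → ℍ[ℝ])
    (hfdef : ∀ p ∈ Ω, f p =
      (((F ((p.re : ℂ) + (rr p : ℂ) * Complex.I)).re : ℝ) : ℍ[ℝ]) +
        iota p * (((F ((p.re : ℂ) + (rr p : ℂ) * Complex.I)).im : ℝ) : ℍ[ℝ])) :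
    ∀ p ∈ Ω, DifferentiableAt ℝ f p ∧
      Dl f p = ((-2 * (F ((p.re : ℂ) + (rr p : ℂ) * Complex.I)).im / rr p : ℝ) : ℍ[ℝ]) ∧
      Dr f p = ((-2 * (F ((p.re : ℂ) + (rr p : ℂ) * Complex.I)).im / rr p : ℝ) : ℍ[ℝ]) := by
  intro p hpΩ
  have hopen : IsOpen Ω := by
    rw [hΩdef]
    exact (isOpen_ne.preimage qimL.continuous).inter (hΩc.preimage continuous_halfPlanePoint)
  have hp : qim p ≠ 0 ∧ halfPlanePoint p ∈ Ωc := by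
    rw [hΩdef] at hpΩ
    exact hpΩ
  have hr := rr_ne_zero hp.1
  have hF' := (hF.differentiableAt (hΩc.mem_nhds hp.2)).hasDerivAt
  have hfe : f =ᶠ[nhds p] intrinsicLift F := by
    filter_upwards [hopen.mem_nhds hpΩ] with q hq using hfdef q hq
  obtain ⟨L, hL, -⟩ := exists_hasFDerivAt_intrinsicLift hr hF'
  refine ⟨hL.differentiableAt.congr_of_eventuallyEq hfe, ?_, ?_⟩
  · rw [Dl, hfe.fderiv_eq]
    exact Dl_intrinsicLift hr hF'
  · rw [Dr, hfe.fderiv_eq]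
    exact Dr_intrinsicLift hr hF'
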